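/- For every positive even integer n, Σ_{0 ≤ k ≤ n, k ≡ 2 (mod 4)} C(n,k) (−1)^{(k-2)/4} 2^{n−k/2} 3^k B_{n-k} = (n/2) ( (−1)^{⌊(n-2)/4⌋} 2^{n/2} · 3^{n-1} + 12 U_{n-1}(2,10) ). -/

import Mathlib

open Finset

/-- The Lucas sequence `U_n(b,c)`: `U_0 = 0`, `U_1 = 1`, `U_{n+2} = b U_{n+1} - c U_n`. -/
def lucasU (b c : ℚ) : ℕ → ℚ
  | 0 => 0
  | 1 => 1
  | n + 2 => b * lucasU b c (n + 1) - c * lucasU b c n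

theorem lucasU_eq_of_add_of_mul {b c : ℚ} {r s : ℂ} (hb : r + s = b) (hc : r * s = c) (n : ℕ) :
    (r - s) * (lucasU b c n : ℂ) = r ^ n - s ^ n := by
  induction n using Nat.twoStepInduction with
  | zero => simp [lucasU]
  | one => simp [lucasU]
  | more n h₀ h₁ =>
    simp only [lucasU, Rat.cast_sub, Rat.cast_mul, ← hb, ← hc]
    linear_combination (r + s) * h₁ - r * s * h₀

theorem aeval_bernoulli_add_one (n : ℕ) (z : ℂ) :
    Polynomial.aeval (z + 1) (Polynomial.bernoulli n)
      = Polynomial.aeval z (Polynomial.bernoulli n) + n * z ^ (n - 1) := by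
  have h := congrArg (Polynomial.aeval z) (Polynomial.bernoulli_comp_one_add_X n)
  simpa [Polynomial.aeval_comp, add_comm] using h

theorem aeval_bernoulli_one_sub {n : ℕ} (hn : Even n) (z : ℂ) :
    Polynomial.aeval (1 - z) (Polynomial.bernoulli n)
      = Polynomial.aeval z (Polynomial.bernoulli n) := by
  have h := congrArg (Polynomial.aeval z) (Polynomial.bernoulli_comp_one_sub_X n)
  simpa [Polynomial.aeval_comp, hn.neg_one_pow] using h

theorem aeval_bernoulli_eq_sum (n : ℕ) (z : ℂ) :
    Polynomial.aeval z (Polynomial.bernoulli n)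
      = ∑ k ∈ range (n + 1), ((n.choose k * bernoulli (n - k) : ℚ) : ℂ) * z ^ k := by
  rw [Polynomial.bernoulli_def, map_sum]
  refine sum_congr rfl fun k _ => ?_
  simp [Polynomial.aeval_monomial, mul_comm]

/-- The imaginary part of the Bernoulli polynomial of even degree `n` at `3(1+i)/2`. -/
theorem two_pow_mul_aeval_bernoulli_im {n : ℕ} (hn : 0 < n) (heven : Even n) :
    2 ^ n * (Polynomial.aeval (⟨3 / 2, 3 / 2⟩ : ℂ) (Polynomial.bernoulli n)).im
      = 6 * n * (lucasU 2 10 (n - 1) : ℝ) := by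
  set x : ℂ := ⟨3 / 2, 3 / 2⟩ with hx
  have hconj : Polynomial.aeval (starRingEnd ℂ x) (Polynomial.bernoulli n)
      = starRingEnd ℂ (Polynomial.aeval x (Polynomial.bernoulli n)) := by
    simp [aeval_bernoulli_eq_sum]
  have hrefl := aeval_bernoulli_one_sub heven (x - 2)
  have hsum : 1 - (x - 2) = starRingEnd ℂ x := by
    apply Complex.ext <;> norm_num [hx]
  have h₁ := aeval_bernoulli_add_one n (x - 1)
  have h₂ := aeval_bernoulli_add_one n (x - 2)
  rw [show x - 1 + 1 = x by ring] at h₁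
  rw [show x - 2 + 1 = x - 1 by ring] at h₂
  rw [hsum, hconj] at hrefl
  obtain ⟨m, rfl⟩ : ∃ m, n = m + 1 := ⟨n - 1, by omega⟩
  have hodd : Odd m := by grind
  have hU := lucasU_eq_of_add_of_mul (b := 2) (c := 10) (r := 2 * (x - 1)) (s := -(2 * (x - 2)))
    (by push_cast; ring) (by apply Complex.ext <;> norm_num [hx]) m
  rw [hodd.neg_pow, mul_pow, mul_pow] at hU
  simp only [Nat.add_sub_cancel] at h₁ h₂ ⊢
  have hsub := Complex.sub_conj (Polynomial.aeval x (Polynomial.bernoulli (m + 1)))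
  have hdiff : 2 * (x - 1) - -(2 * (x - 2)) = 6 * Complex.I := by
    apply Complex.ext <;> norm_num [hx]
  rw [hdiff] at hU
  set w := Polynomial.aeval x (Polynomial.bernoulli (m + 1)) with hw
  have key : (2 * Complex.I) * (2 ^ (m + 1) * (w.im : ℂ))
      = (2 * Complex.I) * (6 * (m + 1 : ℕ) * (lucasU 2 10 m : ℂ)) := by
    push_cast at hsub h₁ h₂ ⊢
    linear_combination (-2 ^ (m + 1)) * hsub - 2 ^ (m + 1) * hrefl + 2 ^ (m + 1) * (h₁ + h₂)
      - 2 * (m + 1) * hU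
  have key' := mul_left_cancel₀ (by simp) key
  exact_mod_cast key'

theorem three_halves_pow_four_mul_add (q r : ℕ) :
    (⟨3 / 2, 3 / 2⟩ : ℂ) ^ (4 * q + r)
      = (((-1) ^ q * 3 ^ (4 * q) / 4 ^ q : ℝ) : ℂ) * (⟨3 / 2, 3 / 2⟩ : ℂ) ^ r := by
  have h : (⟨3 / 2, 3 / 2⟩ : ℂ) ^ 4 = ((-1 * 3 ^ 4 / 4 : ℝ) : ℂ) := by
    apply Complex.ext <;> norm_num [pow_succ]
  rw [pow_add, pow_mul, h, ← Complex.ofReal_pow, div_pow, mul_pow, ← pow_mul]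

theorem two_pow_mul_im_pow_of_mod_four_eq_two {n k : ℕ} (hk : k % 4 = 2) (hkn : k ≤ n) :
    2 ^ n * ((⟨3 / 2, 3 / 2⟩ : ℂ) ^ k).im
      = (-1) ^ ((k - 2) / 4) * 2 ^ (n - k / 2) * 3 ^ k := by
  obtain ⟨q, rfl⟩ : ∃ q, k = 4 * q + 2 := ⟨k / 4, by omega⟩
  obtain ⟨d, rfl⟩ : ∃ d, n = 4 * q + 2 + d := ⟨n - (4 * q + 2), by omega⟩
  rw [three_halves_pow_four_mul_add, Complex.im_ofReal_mul,
    show (4 * q + 2 - 2) / 4 = q by omega,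
    show 4 * q + 2 + d - (4 * q + 2) / 2 = 2 * q + 1 + d by omega]
  have h4 : (2 : ℝ) ^ (4 * q) = 4 ^ q * 4 ^ q := by
    rw [← mul_pow, pow_mul]; norm_num
  have h2 : (2 : ℝ) ^ (2 * q) = 4 ^ q := by rw [pow_mul]; norm_num
  simp only [pow_add, h4, h2]
  norm_num [pow_succ]
  field_simp
  norm_num

theorem im_pow_of_mod_four_eq_zero {k : ℕ} (hk : k % 4 = 0) :
    ((⟨3 / 2, 3 / 2⟩ : ℂ) ^ k).im = 0 := by
  obtain ⟨q, rfl⟩ : ∃ q, k = 4 * q + 0 := ⟨k / 4, by omega⟩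
  rw [three_halves_pow_four_mul_add, Complex.im_ofReal_mul]
  simp

theorem two_pow_mul_im_pow_sub_one {n : ℕ} (hn : 0 < n) (heven : Even n) :
    2 ^ n * ((⟨3 / 2, 3 / 2⟩ : ℂ) ^ (n - 1)).im
      = (-1) ^ ((n - 2) / 4) * 2 ^ (n / 2) * 3 ^ (n - 1) := by
  have h4 (q : ℕ) : (2 : ℝ) ^ (4 * q) = 4 ^ q * 4 ^ q := by
    rw [← mul_pow, pow_mul]; norm_num
  have h2 (q : ℕ) : (2 : ℝ) ^ (2 * q) = 4 ^ q := by rw [pow_mul]; norm_num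
  obtain ⟨q, rfl | rfl⟩ : ∃ q, n = 4 * q + 2 ∨ n = 4 * q + 4 := ⟨(n - 2) / 4, by grind⟩
  · rw [show 4 * q + 2 - 1 = 4 * q + 1 by omega, three_halves_pow_four_mul_add,
      Complex.im_ofReal_mul, show (4 * q + 2 - 2) / 4 = q by omega,
      show (4 * q + 2) / 2 = 2 * q + 1 by omega]
    simp only [pow_add, h4, h2]
    norm_num
    field_simp
    norm_num
  · rw [show 4 * q + 4 - 1 = 4 * q + 3 by omega, three_halves_pow_four_mul_add,
      Complex.im_ofReal_mul, show (4 * q + 4 - 2) / 4 = q by omega,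
      show (4 * q + 4) / 2 = 2 * q + 2 by omega]
    simp only [pow_add, h4, h2]
    norm_num [pow_succ]
    field_simp
    norm_num

theorem sum_choose_three_pow_bernoulli_mod_four (n : ℕ) (hn : 0 < n) (heven : Even n) :
    ∑ k ∈ (Finset.range (n + 1)).filter (fun k => k % 4 = 2),
      (n.choose k : ℚ) * (-1 : ℚ) ^ ((k - 2) / 4) * 2 ^ (n - k / 2) * 3 ^ k
        * bernoulli (n - k)
    = (n : ℚ) / 2 *
        ((-1 : ℚ) ^ ((n - 2) / 4) * 2 ^ (n / 2) * 3 ^ (n - 1)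
          + 12 * lucasU 2 10 (n - 1)) := by
  have him := two_pow_mul_aeval_bernoulli_im hn heven
  rw [aeval_bernoulli_eq_sum, Complex.im_sum, mul_sum,
    ← sum_filter_add_sum_filter_not _ (fun k => k % 4 = 2)] at him
  have hrest : ∑ k ∈ (range (n + 1)).filter (fun k => ¬ k % 4 = 2),
      (2 : ℝ) ^ n * (((n.choose k * bernoulli (n - k) : ℚ) : ℂ) * (⟨3 / 2, 3 / 2⟩ : ℂ) ^ k).im
      = -(n / 2) * ((-1) ^ ((n - 2) / 4) * 2 ^ (n / 2) * 3 ^ (n - 1)) := by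
    rw [sum_eq_single_of_mem (n - 1) (by grind)]
    · rw [← two_pow_mul_im_pow_sub_one hn heven, Nat.choose_symm (by omega), Nat.choose_one_right,
        show n - (n - 1) = 1 by omega, bernoulli_one, ← Complex.ofReal_ratCast,
        Complex.im_ofReal_mul]
      push_cast
      ring
    · intro k hk hne
      rw [← Complex.ofReal_ratCast, Complex.im_ofReal_mul]
      rcases Nat.even_or_odd k with hk' | hk'
      · rw [im_pow_of_mod_four_eq_zero (by grind), mul_zero, mul_zero]
      · rw [bernoulli_eq_zero_of_odd (by grind) (by grind)]
        simp
  have hmain : ∑ k ∈ (range (n + 1)).filter (fun k => k % 4 = 2),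
      (2 : ℝ) ^ n * (((n.choose k * bernoulli (n - k) : ℚ) : ℂ) * (⟨3 / 2, 3 / 2⟩ : ℂ) ^ k).im
      = ((∑ k ∈ (Finset.range (n + 1)).filter (fun k => k % 4 = 2),
      (n.choose k : ℚ) * (-1 : ℚ) ^ ((k - 2) / 4) * 2 ^ (n - k / 2) * 3 ^ k
        * bernoulli (n - k) : ℚ) : ℝ) := by
    rw [Rat.cast_sum]
    refine sum_congr rfl fun k hk => ?_
    simp only [mem_filter, mem_range] at hk
    have h := two_pow_mul_im_pow_of_mod_four_eq_two hk.2 (Nat.le_of_lt_succ hk.1)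
    rw [← Complex.ofReal_ratCast, Complex.im_ofReal_mul]
    push_cast
    linear_combination (n.choose k * bernoulli (n - k) : ℝ) * h
  rw [hmain, hrest] at him
  apply Rat.cast_injective (α := ℝ)
  push_cast at him ⊢
  linear_combination him
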